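/- Let d ≥ 1 be an integer, α ∈ (0, 2), and let u : ℝ^d → ℝ be given by u(x) = (1 + |x|²)^{-(d+1)/2}. Then for every x ∈ ℝ^d with |x| < 1 the principal value limit defining the fractional Laplacian of u at x exists, and C_{d,α} · lim_{ε→0⁺} ∫_{{y : |x−y| > ε}} (u(x) − u(y)) / |x − y|^{d+α} dy = (2^{1−d} √π Γ(d+α) / (Γ(d/2) Γ((d+1)/2))) · Σ_{k=0}^{∞} [ ((d+α)/2)_k · ((d+1+α)/2)_k / ( (d/2)_k · k! ) ] · (−|x|²)^k, where the series (the Gauss hypergeometric series ₂F₁((d+α)/2, (d+1+α)/2; d/2; −|x|²)) converges absolutely since |x| < 1. -/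

import Mathlib

open MeasureTheory Real Topology Filter Polynomial

/-- The normalization constant `C_{d,α} = 2^{α-1} α Γ((α+d)/2) / (π^{d/2} Γ(1-α/2))`
of the fractional Laplacian. -/
noncomputable def fracLapConst (d : ℕ) (α : ℝ) : ℝ :=
  2 ^ (α - 1) * α * Real.Gamma ((α + d) / 2) /
    (Real.pi ^ ((d : ℝ) / 2) * Real.Gamma (1 - α / 2))


set_option linter.unusedSectionVars false

theorem aux_gam_int {a r : ℝ} (ha : 0 < a) (hr : 0 < r) :
    IntegrableOn (fun t : ℝ => t ^ (a - 1) * rexp (-(r * t))) (Set.Ioi 0) := by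
  have := integrableOn_rpow_mul_exp_neg_mul_rpow (p := 1) (s := a - 1) (b := r) (by linarith)
    one_pos hr
  simpa using this

theorem aux_gam {a r : ℝ} (ha : 0 < a) (hr : 0 < r) :
    ∫ t in Set.Ioi (0 : ℝ), t ^ (a - 1) * rexp (-(r * t)) = r ^ (-a) * Real.Gamma a := by
  rw [Real.integral_rpow_mul_exp_neg_mul_Ioi ha hr, one_div, inv_rpow hr.le, rpow_neg hr.le]

theorem aux_beta {p q : ℝ} (hp : 0 < p) (hq : 0 < q) :
    IntegrableOn (fun t : ℝ => t ^ (p - 1) * (1 + t) ^ (-(p + q))) (Set.Ioi 0) ∧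
    ∫ t in Set.Ioi (0 : ℝ), t ^ (p - 1) * (1 + t) ^ (-(p + q)) =
      Real.Gamma p * Real.Gamma q / Real.Gamma (p + q) := by
  set μ : Measure ℝ := volume.restrict (Set.Ioi 0) with hμ
  let F : ℝ × ℝ → ℝ := fun z => z.1 ^ (p - 1) * (z.2 ^ (p + q - 1) * rexp (-((1 + z.1) * z.2)))
  have hG : 0 < Real.Gamma (p + q) := Real.Gamma_pos_of_pos (by positivity)
  have hmeas : AEStronglyMeasurable F (μ.prod μ) := by
    have : Measurable F := by fun_prop
    exact this.aestronglyMeasurable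
  have inner2 : ∀ v ∈ Set.Ioi (0 : ℝ), ∫ t, F (t, v) ∂μ = Real.Gamma p * (v ^ (q - 1) * rexp (-(1 * v))) := by
    intro v (hv : 0 < v)
    have : ∀ t, F (t, v) = (v ^ (p + q - 1) * rexp (-v)) * (t ^ (p - 1) * rexp (-(v * t))) := by
      intro t
      simp only [F]
      rw [show -((1 + t) * v) = -v + -(v * t) by ring, Real.exp_add]; ring
    simp_rw [this]
    rw [integral_const_mul, aux_gam hp hv, show q - 1 = (p + q - 1) + (-p) by ring, rpow_add hv, one_mul]
    ring
  have inner1 : ∀ t ∈ Set.Ioi (0 : ℝ), ∫ v, F (t, v) ∂μ =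
      Real.Gamma (p + q) * (t ^ (p - 1) * (1 + t) ^ (-(p + q))) := by
    intro t (ht : 0 < t)
    simp only [F]
    rw [integral_const_mul, aux_gam (by positivity) (by positivity)]
    ring
  have hIntg : Integrable F (μ.prod μ) := by
    rw [integrable_prod_iff' hmeas]
    constructor
    · filter_upwards [ae_restrict_mem measurableSet_Ioi] with v (hv : 0 < v)
      have : ∀ t, F (t, v) = (v ^ (p + q - 1) * rexp (-v)) * (t ^ (p - 1) * rexp (-(v * t))) := by
        intro t
        simp only [F]
        rw [show -((1 + t) * v) = -v + -(v * t) by ring, Real.exp_add]; ring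
      simp_rw [this]
      exact (aux_gam_int hp hv).const_mul _
    · have h := (aux_gam_int hq one_pos).const_mul (Real.Gamma p)
      refine Integrable.congr h ?_
      filter_upwards [ae_restrict_mem measurableSet_Ioi] with v hv
      rw [← inner2 v hv]
      refine setIntegral_congr_fun measurableSet_Ioi fun t (ht : 0 < t) => ?_
      have hv' : 0 < v := hv
      have : 0 ≤ F (t, v) := by positivity
      exact (Real.norm_of_nonneg this).symm
  have hL := hIntg.integral_prod_left
  have e1 : (fun t => ∫ v, F (t, v) ∂μ) =ᵐ[μ]
      fun t => Real.Gamma (p + q) * (t ^ (p - 1) * (1 + t) ^ (-(p + q))) := by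
    filter_upwards [ae_restrict_mem measurableSet_Ioi] with t ht using inner1 t ht
  constructor
  · have := (hL.congr e1).const_mul (Real.Gamma (p + q))⁻¹
    refine this.congr (ae_of_all _ fun t => ?_)
    field_simp
  · have h := integral_integral_swap (f := fun t v => F (t, v)) hIntg
    rw [integral_congr_ae e1] at h
    have e2 : (fun v => ∫ t, F (t, v) ∂μ) =ᵐ[μ]
      fun v => Real.Gamma p * (v ^ (q - 1) * rexp (-(1 * v))) := by
      filter_upwards [ae_restrict_mem measurableSet_Ioi] with t ht using inner2 t ht
    rw [integral_congr_ae e2, integral_const_mul, integral_const_mul, aux_gam hq one_pos, one_rpow, one_mul] at h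
    rw [eq_div_iff hG.ne', ← h]
    ring

theorem aux_bern {b w : ℝ} (h0 : 0 < w) (h1 : w ≤ 1) :
    1 - w ^ b ≤ max 1 b * (1 - w) := by
  rcases le_total b 1 with h | h
  · rw [max_eq_left h]
    have : w ≤ w ^ b := by
      simpa using Real.rpow_le_rpow_of_exponent_ge h0 h1 h
    linarith
  · rw [max_eq_right h]
    have := one_add_mul_self_le_rpow_one_add (s := w - 1) (by linarith) h
    rw [show 1 + (w - 1) = w by ring] at this
    linarith

theorem aux_key {a b : ℝ} (ha : 0 < a) (ha1 : a < 1) (hb : 0 < b) :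
    IntegrableOn (fun t : ℝ => t ^ (a - 1) * (1 - (t / (1 + t)) ^ b)) (Set.Ioi 0) ∧
    ∫ t in Set.Ioi (0 : ℝ), t ^ (a - 1) * (1 - (t / (1 + t)) ^ b) =
      Real.Gamma (1 - a) / a * (Real.Gamma (b + a) / Real.Gamma b) := by
  have bd : ∀ t : ℝ, 0 < t → 0 ≤ 1 - (t / (1 + t)) ^ b ∧
      1 - (t / (1 + t)) ^ b ≤ max 1 b * (1 + t)⁻¹ := by
    intro t ht
    have hw1 : t / (1 + t) ≤ 1 := by rw [div_le_one (by positivity)]; linarith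
    constructor
    · have := Real.rpow_le_one (by positivity : 0 ≤ t / (1 + t)) hw1 hb.le
      linarith
    · have := aux_bern (b := b) (by positivity : 0 < t / (1 + t)) hw1
      have e : 1 - t / (1 + t) = (1 + t)⁻¹ := by field_simp; ring
      rwa [e] at this
  have int1 : IntegrableOn (fun t : ℝ => t ^ (a - 1) * (1 - (t / (1 + t)) ^ b)) (Set.Ioi 0) := by
    have h := ((aux_beta ha (by linarith : 0 < 1 - a)).1).const_mul (max 1 b)
    refine Integrable.mono' h (by
      have : Measurable (fun t : ℝ => t ^ (a - 1) * (1 - (t / (1 + t)) ^ b)) := by fun_prop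
      exact this.aestronglyMeasurable) ?_
    filter_upwards [ae_restrict_mem measurableSet_Ioi] with t (ht : 0 < t)
    obtain ⟨h1, h2⟩ := bd t ht
    rw [Real.norm_of_nonneg (by positivity), show -(a + (1 - a)) = -1 by ring, rpow_neg_one]
    have : 0 ≤ t ^ (a - 1) := by positivity
    nlinarith
  refine ⟨int1, ?_⟩
  obtain ⟨int2, val2⟩ := aux_beta (p := b + a) (q := 1 - a) (by positivity) (by linarith)
  have hbg : Real.Gamma (b + a + (1 - a)) = b * Real.Gamma b := by
    rw [← Real.Gamma_add_one hb.ne']; ring_nf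
  rw [hbg] at val2
  let G : ℝ → ℝ := fun t => t ^ a * (1 - (t / (1 + t)) ^ b)
  have hG0 : G 0 = 0 := by simp [G, Real.zero_rpow ha.ne']
  have der : ∀ t ∈ Set.Ioi (0 : ℝ), HasDerivAt G (a * (t ^ (a - 1) * (1 - (t / (1 + t)) ^ b))
      - b * (t ^ (b + a - 1) * (1 + t) ^ (-(b + a + (1 - a))))) t := by
    intro t (ht : 0 < t)
    have hw : HasDerivAt (fun t : ℝ => t / (1 + t)) ((1 * (1 + t) - t * 1) / (1 + t) ^ 2) t := by
      exact (hasDerivAt_id t).div ((hasDerivAt_id t).const_add 1) (by positivity)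
    have hw2 := hw.rpow_const (p := b) (Or.inl (by positivity))
    have h1 := (hasDerivAt_id t).rpow_const (p := a) (Or.inl ht.ne')
    have h := h1.mul (hw2.const_sub 1)
    refine h.congr_deriv ?_
    simp only [id]
    rw [show -(b + a + (1 - a)) = -(b - 1) - 2 by ring, rpow_sub (by positivity : 0 < 1 + t),
      rpow_neg (by positivity), show b + a - 1 = a + (b - 1) by ring, rpow_add ht,
      div_rpow ht.le (by positivity) (b - 1), rpow_two]
    field_simp
    ring
  have hlim : Tendsto G atTop (𝓝 0) := by
    have h1 : Tendsto (fun t : ℝ => max 1 b * t ^ (-(1 - a))) atTop (𝓝 0) := by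
      simpa using (tendsto_rpow_neg_atTop (by linarith : 0 < 1 - a)).const_mul (max 1 b)
    refine squeeze_zero' ?_ ?_ h1
    · filter_upwards [eventually_gt_atTop 0] with t ht
      have := (bd t ht).1
      positivity
    · filter_upwards [eventually_gt_atTop 0] with t ht
      obtain ⟨h1, h2⟩ := bd t ht
      have h3 : (1 + t)⁻¹ ≤ t⁻¹ := by gcongr; linarith
      have hm : 0 ≤ max 1 b := by positivity
      calc G t ≤ t ^ a * (max 1 b * t⁻¹) := by
            simp only [G]; gcongr; exact h2.trans (by gcongr)
        _ = _ := by rw [show -(1 - a) = a + -1 by ring, rpow_add ht, rpow_neg_one]; ring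
  have hcont : ContinuousWithinAt G (Set.Ici 0) 0 := by
    have : Tendsto (fun t : ℝ => t ^ a) (𝓝[Set.Ici 0] 0) (𝓝 0) := by
      have := (Real.continuousAt_rpow_const (0:ℝ) a (Or.inr ha.le)).continuousWithinAt (s := Set.Ici 0)
      unfold ContinuousWithinAt at this
      simpa [Real.zero_rpow ha.ne'] using this
    unfold ContinuousWithinAt
    rw [hG0]
    refine squeeze_zero' ?_ ?_ this
    · filter_upwards [self_mem_nhdsWithin] with t (ht : 0 ≤ t)
      rcases ht.eq_or_lt with rfl | ht
      · rw [hG0]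
      · have := (bd t ht).1
        positivity
    · filter_upwards [self_mem_nhdsWithin] with t (ht : 0 ≤ t)
      simp only [G]
      have h1 : 0 ≤ (t / (1 + t)) ^ b := by positivity
      have h2 : 0 ≤ t ^ a := by positivity
      nlinarith
  have main := integral_Ioi_of_hasDerivAt_of_tendsto hcont der
    ((int1.const_mul a).sub (int2.const_mul b)) hlim
  have e := integral_sub (int1.const_mul a) (int2.const_mul b)
  rw [e, integral_const_mul, integral_const_mul, val2, hG0, sub_zero] at main
  have hgb := Real.Gamma_pos_of_pos hb
  have : ∫ t in Set.Ioi (0 : ℝ), t ^ (a - 1) * (1 - (t / (1 + t)) ^ b) =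
      (b * (Real.Gamma (b + a) * Real.Gamma (1 - a) / (b * Real.Gamma b))) / a := by
    field_simp at main ⊢
    linarith
  rw [this]
  field_simp

theorem aux_binom (q z : ℝ) (hz : |z| < 1) :
    HasSum (fun k : ℕ => (ascPochhammer ℝ k).eval q / (k.factorial : ℝ) * z ^ k)
      ((1 - z) ^ (-q)) := by
  have h := (Real.one_div_one_sub_rpow_hasFPowerSeriesOnBall_zero q).hasSum (y := z)
    (by simpa [enorm_eq_nnnorm] using! hz)
  have h1 : 0 ≤ 1 - z := by linarith [(abs_lt.mp hz).2]
  simp only [zero_add] at h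
  rw [rpow_neg h1, ← one_div]
  have e : (fun k : ℕ => (ascPochhammer ℝ k).eval q / (k.factorial : ℝ) * z ^ k) =
      fun n => (FormalMultilinearSeries.ofScalars ℝ (fun n => Ring.choose (q + (n : ℝ) - 1) n) n)
        fun _ => z := by
    funext k
    rw [FormalMultilinearSeries.ofScalars_apply_eq, smul_eq_mul]
    congr 1
    rw [Ring.choose_eq_smul, Polynomial.descPochhammer_smeval_eq_ascPochhammer]
    rw [show q + k - 1 - k + 1 = q by ring, Polynomial.ascPochhammer_smeval_cast,
      Polynomial.ascPochhammer_smeval_eq_eval]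
    rw [smul_eq_mul, div_eq_inv_mul]
  rw [e]
  exact h

theorem aux_gamma (b : ℝ) (hb : 0 < b) (k : ℕ) :
    Real.Gamma (b + k) = (ascPochhammer ℝ k).eval b * Real.Gamma b := by
  induction k with
  | zero => simp
  | succ n ih =>
    rw [ascPochhammer_succ_eval]
    push_cast
    rw [← add_assoc, Real.Gamma_add_one (by positivity), ih]; ring

theorem aux_summable (a b c z : ℝ) (ha : 0 < a) (hb : 0 < b) (hc : 0 < c) (hz : |z| < 1) :
    Summable (fun k : ℕ => |((ascPochhammer ℝ k).eval a * (ascPochhammer ℝ k).eval b /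
      ((ascPochhammer ℝ k).eval c * (Nat.factorial k : ℝ))) * z ^ k|) := by
  have h := ordinaryHypergeometricSeries_radius_eq_one ℝ a b c
    (fun k => ⟨by have : (0:ℝ) ≤ k := k.cast_nonneg
                  linarith, by have : (0:ℝ) ≤ k := k.cast_nonneg
                               constructor <;> linarith⟩)
  have := (ordinaryHypergeometricSeries ℝ a b c).summable_norm_apply (x := z)
    (by rw [h]; simpa [enorm_eq_nnnorm] using! hz)
  refine this.congr fun k => ?_
  rw [ordinaryHypergeometricSeries_apply_eq, Real.norm_eq_abs, smul_eq_mul]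
  congr 1
  field_simp

theorem aux_final {a q c ρ : ℝ} (ha : 0 < a) (ha1 : a < 1) (hq : 0 < q) (hc : 0 < c)
    (h0 : 0 ≤ ρ) (h1 : ρ < 1) :
    ∫ t in Set.Ioi (0 : ℝ), t ^ (a - 1) *
      ((1 + ρ) ^ (-q) - (t / (1 + t)) ^ c * (1 + t / (1 + t) * ρ) ^ (-q)) =
    Real.Gamma (1 - a) / a * (Real.Gamma (c + a) / Real.Gamma c) *
      ∑' k : ℕ, ((ascPochhammer ℝ k).eval (c + a) * (ascPochhammer ℝ k).eval q /
        ((ascPochhammer ℝ k).eval c * (Nat.factorial k : ℝ))) * (-ρ) ^ k := by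
  set A := Real.Gamma (1 - a) / a * (Real.Gamma (c + a) / Real.Gamma c) with hA
  let T : ℕ → ℝ := fun k => ((ascPochhammer ℝ k).eval (c + a) * (ascPochhammer ℝ k).eval q /
        ((ascPochhammer ℝ k).eval c * (Nat.factorial k : ℝ))) * (-ρ) ^ k
  have hTs : Summable fun k => |T k| :=
    aux_summable (c + a) q c (-ρ) (by positivity) hq hc (by rw [abs_neg, abs_of_nonneg h0]; exact h1)
  have hgc := Real.Gamma_pos_of_pos hc
  let F : ℕ → ℝ → ℝ := fun k t => ((ascPochhammer ℝ k).eval q / (k.factorial : ℝ) * (-ρ) ^ k) *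
    (t ^ (a - 1) * (1 - (t / (1 + t)) ^ (c + k)))
  have hpos : ∀ b : ℝ, 0 < b → ∀ k, 0 < (ascPochhammer ℝ k).eval b :=
    fun b hb k => ascPochhammer_pos k b hb
  have hFval : ∀ k, ((ascPochhammer ℝ k).eval q / (k.factorial : ℝ) * (-ρ) ^ k) *
      (Real.Gamma (1 - a) / a * (Real.Gamma (c + k + a) / Real.Gamma (c + k))) = A * T k := by
    intro k
    rw [show c + k + a = (c + a) + k by ring, aux_gamma c hc, aux_gamma (c + a) (by positivity)]
    have := hpos c hc k
    simp only [T, hA]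
    field_simp
  have hFint : ∀ k, Integrable (F k) (volume.restrict (Set.Ioi 0)) := fun k =>
    (aux_key ha ha1 (by positivity : 0 < c + k)).1.const_mul _
  have hFnorm : ∀ k, ∫ t in Set.Ioi (0 : ℝ), ‖F k t‖ = |A * T k| := by
    intro k
    have hk := aux_key ha ha1 (by positivity : 0 < c + k)
    have e : ∫ t in Set.Ioi (0 : ℝ), ‖F k t‖ = ∫ t in Set.Ioi (0 : ℝ),
        |((ascPochhammer ℝ k).eval q / (k.factorial : ℝ) * (-ρ) ^ k)| *
          (t ^ (a - 1) * (1 - (t / (1 + t)) ^ (c + k))) := by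
      refine setIntegral_congr_fun measurableSet_Ioi fun t (ht : 0 < t) => ?_
      simp only [F]
      rw [norm_mul, Real.norm_eq_abs, Real.norm_of_nonneg]
      have : (t / (1 + t)) ^ (c + k) ≤ 1 := by
        apply Real.rpow_le_one (by positivity) _ (by positivity)
        rw [div_le_one (by positivity)]; linarith
      have := sub_nonneg.2 this
      positivity
    rw [e, integral_const_mul, hk.2, ← hFval]
    have hg : 0 < Real.Gamma (1 - a) := Real.Gamma_pos_of_pos (by linarith)
    have hnn : 0 ≤ Real.Gamma (1 - a) / a * (Real.Gamma (c + k + a) / Real.Gamma (c + k)) := by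
      positivity
    generalize Real.Gamma (1 - a) / a * (Real.Gamma (c + k + a) / Real.Gamma (c + k)) = B at hnn ⊢
    rw [abs_mul _ B, abs_of_nonneg hnn]
  have hsum := hasSum_integral_of_summable_integral_norm hFint (by
    simp_rw [hFnorm, abs_mul]
    exact hTs.mul_left _)
  have e2 : ∀ k, ∫ t in Set.Ioi (0 : ℝ), F k t = A * T k := by
    intro k
    simp only [F]
    rw [integral_const_mul, (aux_key ha ha1 (by positivity : 0 < c + k)).2, hFval]
  simp_rw [e2] at hsum
  have e3 : ∫ t in Set.Ioi (0 : ℝ), ∑' k, F k t = ∫ t in Set.Ioi (0 : ℝ), t ^ (a - 1) *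
      ((1 + ρ) ^ (-q) - (t / (1 + t)) ^ c * (1 + t / (1 + t) * ρ) ^ (-q)) := by
    refine setIntegral_congr_fun measurableSet_Ioi fun t (ht : 0 < t) => ?_
    set w := t / (1 + t) with hw
    have hw0 : 0 < w := by positivity
    have hw1 : w ≤ 1 := by rw [hw, div_le_one (by positivity)]; linarith
    have s1 := aux_binom q (-ρ) (by rw [abs_neg, abs_of_nonneg h0]; exact h1)
    have s2 := aux_binom q (-(w * ρ)) (by
      rw [abs_neg, abs_of_nonneg (by positivity)]; nlinarith)
    rw [sub_neg_eq_add] at s1 s2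
    have s3 := (s1.sub (s2.mul_left (w ^ c))).mul_left (t ^ (a - 1))
    rw [← s3.tsum_eq]
    refine tsum_congr fun k => ?_
    simp only [F]
    rw [← hw, rpow_add hw0, rpow_natCast, neg_pow (w * ρ), mul_pow, neg_pow ρ]
    ring
  rw [← e3, ← hsum.tsum_eq, tsum_mul_left]

/-- symmetrised second difference of a Gaussian -/
noncomputable def auxD {V : Type*} [NormedAddCommGroup V] (x h : V) (t : ℝ) : ℝ :=
  rexp (-(t * ‖x‖ ^ 2)) - (rexp (-(t * ‖x + h‖ ^ 2)) + rexp (-(t * ‖x - h‖ ^ 2))) / 2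

theorem aux_N {f : ℝ → ℝ} {b r : ℝ} (hb : 0 < b) (hr : 0 < r) (hf : Measurable f)
    (hfi : IntegrableOn f (Set.Ioi 0)) :
    Integrable (fun z : ℝ × ℝ => f z.1 * (z.1 ^ b * (z.2 ^ (b - 1) * rexp (-(z.1 * r ^ 2 * z.2)))))
      ((volume.restrict (Set.Ioi 0)).prod (volume.restrict (Set.Ioi 0))) ∧
    ∫ z : ℝ × ℝ, f z.1 * (z.1 ^ b * (z.2 ^ (b - 1) * rexp (-(z.1 * r ^ 2 * z.2))))
      ∂((volume.restrict (Set.Ioi 0)).prod (volume.restrict (Set.Ioi 0))) =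
      (∫ t in Set.Ioi (0 : ℝ), f t) * (Real.Gamma b * (r ^ 2) ^ (-b)) := by
  set μ : Measure ℝ := volume.restrict (Set.Ioi 0) with hμ
  let F : ℝ × ℝ → ℝ := fun z => f z.1 * (z.1 ^ b * (z.2 ^ (b - 1) * rexp (-(z.1 * r ^ 2 * z.2))))
  have hmeas : AEStronglyMeasurable F (μ.prod μ) := by
    have : Measurable F := by fun_prop
    exact this.aestronglyMeasurable
  have sc : ∀ t : ℝ, 0 < t → t ^ b * (t * r ^ 2) ^ (-b) = (r ^ 2) ^ (-b) := by
    intro t ht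
    rw [mul_rpow ht.le (by positivity), ← mul_assoc, ← rpow_add ht]; simp
  have inner : ∀ t ∈ Set.Ioi (0 : ℝ), ∫ s, F (t, s) ∂μ = f t * (Real.Gamma b * (r ^ 2) ^ (-b)) := by
    intro t (ht : 0 < t)
    simp only [F]
    rw [integral_const_mul, integral_const_mul, aux_gam hb (by positivity), ← sc t ht]
    ring
  have innern : ∀ t ∈ Set.Ioi (0 : ℝ), ∫ s, ‖F (t, s)‖ ∂μ =
      ‖f t‖ * (Real.Gamma b * (r ^ 2) ^ (-b)) := by
    intro t (ht : 0 < t)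
    have : ∫ s, ‖F (t, s)‖ ∂μ =
        ∫ s, ‖f t‖ * (t ^ b * (s ^ (b - 1) * rexp (-(t * r ^ 2 * s)))) ∂μ := by
      refine setIntegral_congr_fun measurableSet_Ioi fun s (hs : 0 < s) => ?_
      simp only [F]
      rw [norm_mul, Real.norm_of_nonneg (by positivity :
        0 ≤ (t ^ b * (s ^ (b - 1) * rexp (-(t * r ^ 2 * s)))))]
    rw [this, integral_const_mul, integral_const_mul, aux_gam hb (by positivity), ← sc t ht]
    ring
  have hIntg : Integrable F (μ.prod μ) := by
    rw [integrable_prod_iff hmeas]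
    constructor
    · filter_upwards [ae_restrict_mem measurableSet_Ioi] with t (ht : 0 < t)
      exact ((aux_gam_int hb (by positivity : 0 < t * r ^ 2)).const_mul (t ^ b)).const_mul (f t)
    · refine (hfi.norm.mul_const (Real.Gamma b * (r ^ 2) ^ (-b))).congr ?_
      filter_upwards [ae_restrict_mem measurableSet_Ioi] with t ht using (innern t ht).symm
  refine ⟨hIntg, ?_⟩
  rw [integral_prod _ hIntg, ← integral_mul_const]
  exact setIntegral_congr_fun measurableSet_Ioi inner

theorem auxD_abs_le_one {V : Type*} [NormedAddCommGroup V] (x h : V) {t : ℝ} (ht : 0 < t) : |auxD x h t| ≤ 1 := by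
  have e : ∀ y : V, 0 ≤ rexp (-(t * ‖y‖ ^ 2)) ∧ rexp (-(t * ‖y‖ ^ 2)) ≤ 1 := fun y =>
    ⟨(Real.exp_pos _).le, Real.exp_le_one_iff.2 (by have : 0 ≤ t * ‖y‖ ^ 2 := by positivity
                                                    linarith)⟩
  have h1 := e x
  have h2 := e (x + h)
  have h3 := e (x - h)
  unfold auxD
  rw [abs_le]; constructor <;> linarith

section geom
variable {V : Type*} [NormedAddCommGroup V] [InnerProductSpace ℝ V]

theorem auxD_abs_le_sq (x h : V) (hx : ‖x‖ ≤ 1) {t : ℝ} (ht : 0 < t) :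
    |auxD x h t| ≤ (t + 2 * t ^ 2) * ‖h‖ ^ 2 := by
  set c := 2 * t * inner ℝ x h with hc
  set X := rexp (-(t * ‖x‖ ^ 2)) with hX
  set H := rexp (-(t * ‖h‖ ^ 2)) with hH
  have e1 : rexp (-(t * ‖x + h‖ ^ 2)) = X * H * rexp (-c) := by
    rw [hX, hH, ← Real.exp_add, ← Real.exp_add, norm_add_sq_real, hc]; ring_nf
  have e2 : rexp (-(t * ‖x - h‖ ^ 2)) = X * H * rexp c := by
    rw [hX, hH, ← Real.exp_add, ← Real.exp_add, norm_sub_sq_real, hc]; ring_nf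
  have X0 : 0 < X := Real.exp_pos _
  have X1 : X ≤ 1 := Real.exp_le_one_iff.2 (by have : 0 ≤ t * ‖x‖ ^ 2 := by positivity
                                               linarith)
  have H0 : 0 < H := Real.exp_pos _
  have H1 : H ≤ 1 := Real.exp_le_one_iff.2 (by have : 0 ≤ t * ‖h‖ ^ 2 := by positivity
                                               linarith)
  have H2 : 1 - t * ‖h‖ ^ 2 ≤ H := by
    have := Real.add_one_le_exp (-(t * ‖h‖ ^ 2)); linarith
  have eD : auxD x h t = X * (1 - H * Real.cosh c) := by
    unfold auxD; rw [e1, e2, Real.cosh_eq]; ring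
  have hcosh : X * H * Real.cosh c ≤ 1 := by
    have a1 : rexp (-(t * ‖x + h‖ ^ 2)) ≤ 1 :=
      Real.exp_le_one_iff.2 (by have : 0 ≤ t * ‖x + h‖ ^ 2 := by positivity
                                linarith)
    have a2 : rexp (-(t * ‖x - h‖ ^ 2)) ≤ 1 :=
      Real.exp_le_one_iff.2 (by have : 0 ≤ t * ‖x - h‖ ^ 2 := by positivity
                                linarith)
    have : X * H * Real.cosh c = (rexp (-(t * ‖x + h‖ ^ 2)) + rexp (-(t * ‖x - h‖ ^ 2))) / 2 := by
      rw [e1, e2, Real.cosh_eq]; ring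
    rw [this]; linarith
  have c1 : 1 ≤ Real.cosh c := Real.one_le_cosh c
  have c2 : Real.cosh c - 1 ≤ Real.cosh c * (c ^ 2 / 2) := by
    have h1 := Real.cosh_le_exp_half_sq c
    have h2 := Real.add_one_le_exp (-(c ^ 2 / 2))
    have h3 : Real.cosh c * rexp (-(c ^ 2 / 2)) ≤ 1 := by
      rw [Real.exp_neg, ← div_eq_mul_inv, div_le_one (Real.exp_pos _)]; exact h1
    nlinarith
  have hc2 : c ^ 2 / 2 ≤ 2 * t ^ 2 * ‖h‖ ^ 2 := by
    have h1 : (inner ℝ x h) ^ 2 ≤ ‖h‖ ^ 2 := by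
      have := abs_real_inner_le_norm x h
      rw [← sq_abs]
      have h3 : |inner ℝ x h| ≤ ‖h‖ := this.trans (by nlinarith [norm_nonneg h])
      gcongr
    rw [hc]
    have : (2 * t * inner ℝ x h) ^ 2 / 2 = 2 * t ^ 2 * (inner ℝ x h) ^ 2 := by ring
    rw [this]; gcongr
  rw [eD, abs_le]
  have hh : 0 ≤ ‖h‖ ^ 2 := by positivity
  constructor
  · have : X * (H * Real.cosh c - 1) ≤ 2 * t ^ 2 * ‖h‖ ^ 2 := by
      calc X * (H * Real.cosh c - 1) ≤ X * (H * Real.cosh c - H) := by gcongr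
        _ = X * H * (Real.cosh c - 1) := by ring
        _ ≤ X * H * (Real.cosh c * (c ^ 2 / 2)) := by gcongr
        _ = (X * H * Real.cosh c) * (c ^ 2 / 2) := by ring
        _ ≤ 1 * (c ^ 2 / 2) := by gcongr
        _ ≤ _ := by linarith
    nlinarith
  · have : X * (1 - H * Real.cosh c) ≤ t * ‖h‖ ^ 2 := by
      calc X * (1 - H * Real.cosh c) ≤ X * (1 - H * 1) := by gcongr
        _ ≤ X * (t * ‖h‖ ^ 2) := by gcongr; linarith
        _ ≤ 1 * (t * ‖h‖ ^ 2) := by gcongr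
        _ = _ := one_mul _
    nlinarith [mul_nonneg (sq_nonneg t) hh]

theorem auxD_bound (x h : V) (hx : ‖x‖ ≤ 1) {t : ℝ} (ht : 0 < t) :
    |auxD x h t| ≤ (1 + t + 2 * t ^ 2) * min 1 (‖h‖ ^ 2) := by
  rcases le_total 1 (‖h‖ ^ 2) with hh | hh
  · rw [min_eq_left hh]
    have := auxD_abs_le_one x h ht
    nlinarith [sq_nonneg t]
  · rw [min_eq_right hh]
    have := auxD_abs_le_sq x h hx ht
    nlinarith [sq_nonneg ‖h‖]

end geom

section meas
variable {V : Type*} [NormedAddCommGroup V] [InnerProductSpace ℝ V] [FiniteDimensional ℝ V]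
  [MeasurableSpace V] [BorelSpace V]

theorem aux_gauss_int {b : ℝ} (hb : 0 < b) (y : V) :
    Integrable (fun h : V => rexp (-(b * ‖h + y‖ ^ 2))) ∧
    ∫ h : V, rexp (-(b * ‖h + y‖ ^ 2)) = (π / b) ^ (Module.finrank ℝ V / 2 : ℝ) := by
  have h0 := GaussianFourier.integral_rexp_neg_mul_sq_norm (V := V) hb
  have h1 : Integrable (fun h : V => rexp (-b * ‖h‖ ^ 2)) := by
    by_contra hn
    rw [integral_undef hn] at h0
    have : 0 < (π / b) ^ (Module.finrank ℝ V / 2 : ℝ) := by positivity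
    linarith
  simp only [neg_mul] at h0 h1
  exact ⟨h1.comp_add_right y, by rw [integral_add_right_eq_self (fun h : V => rexp (-(b * ‖h‖ ^ 2))) y, h0]⟩

theorem aux_inner_h (x : V) {t σ : ℝ} (ht : 0 < t) (hσ : 0 < σ) :
    ∫ h : V, rexp (-(t * ‖h‖ ^ 2 * σ)) * auxD x h t =
      (π / (t * σ)) ^ (Module.finrank ℝ V / 2 : ℝ) * rexp (-(t * ‖x‖ ^ 2)) -
      (π / (t * (1 + σ))) ^ (Module.finrank ℝ V / 2 : ℝ) *
        rexp (-(t * (σ / (1 + σ) * ‖x‖ ^ 2))) := by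
  have hs : ∀ (y h : V), rexp (-(t * ‖h‖ ^ 2 * σ)) * rexp (-(t * ‖y + h‖ ^ 2)) =
      rexp (-((t * (1 + σ)) * ‖h + (1 / (1 + σ)) • y‖ ^ 2)) *
        rexp (-(t * (σ / (1 + σ) * ‖y‖ ^ 2))) := by
    intro y h
    rw [← Real.exp_add, ← Real.exp_add, norm_add_sq_real, norm_add_sq_real, inner_smul_right,
      norm_smul, Real.norm_of_nonneg (by positivity), real_inner_comm]
    congr 1
    field_simp
    ring
  have i0 := aux_gauss_int (V := V) (by positivity : 0 < t * σ) 0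
  simp only [add_zero] at i0
  have i1 := fun y : V => aux_gauss_int (V := V) (by positivity : 0 < t * (1 + σ)) ((1 / (1 + σ)) • y)
  have e : ∀ h : V, rexp (-(t * ‖h‖ ^ 2 * σ)) * auxD x h t =
      rexp (-(t * σ * ‖h‖ ^ 2)) * rexp (-(t * ‖x‖ ^ 2)) -
      (rexp (-((t * (1 + σ)) * ‖h + (1 / (1 + σ)) • x‖ ^ 2)) *
        rexp (-(t * (σ / (1 + σ) * ‖x‖ ^ 2))) +
       rexp (-((t * (1 + σ)) * ‖h + (1 / (1 + σ)) • (-x)‖ ^ 2)) *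
        rexp (-(t * (σ / (1 + σ) * ‖x‖ ^ 2)))) / 2 := by
    intro h
    have h2 := hs (-x) h
    rw [norm_neg, show -x + h = -(x - h) by abel, norm_neg] at h2
    rw [← h2, ← hs x h, auxD, show t * σ * ‖h‖ ^ 2 = t * ‖h‖ ^ 2 * σ by ring]
    ring
  simp_rw [e]
  rw [integral_sub (i0.1.mul_const _) ((((i1 x).1.mul_const _).fun_add ((i1 (-x)).1.mul_const _)).div_const 2),
    integral_div, integral_add ((i1 x).1.mul_const _) ((i1 (-x)).1.mul_const _)]
  simp only [integral_mul_const]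
  rw [(i1 x).2, (i1 (-x)).2, i0.2]
  ring

theorem aux_g_int [Nontrivial V] {p : ℝ} (hp : (Module.finrank ℝ V : ℝ) < p)
    (hp2 : p < Module.finrank ℝ V + 2) :
    Integrable (fun h : V => min 1 (‖h‖ ^ 2) * (‖h‖ ^ 2) ^ (-(p / 2))) := by
  have hd : 0 < Module.finrank ℝ V := Module.finrank_pos
  have key := (integrable_fun_norm_addHaar (volume : Measure V)
    (f := fun r : ℝ => min 1 (r ^ 2) * (r ^ 2) ^ (-(p / 2)))).2
  apply key
  have e0 : ∀ r : ℝ, 0 < r → (r ^ 2) ^ (-(p / 2)) = r ^ (-p) := by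
    intro r hr
    rw [← rpow_natCast, ← rpow_mul hr.le]; congr 1; push_cast; ring
  have e1 : ∀ r : ℝ, r ^ (Module.finrank ℝ V - 1) = r ^ ((Module.finrank ℝ V : ℝ) - 1) := by
    intro r
    rw [← rpow_natCast, Nat.cast_sub hd]; simp
  rw [← Set.Ioc_union_Ioi_eq_Ioi (zero_le_one (α := ℝ))]
  refine IntegrableOn.union ?_ ?_
  · have h1 : IntegrableOn (fun r : ℝ => r ^ ((Module.finrank ℝ V : ℝ) + 1 - p)) (Set.Ioc 0 1) := by
      rw [← intervalIntegrable_iff_integrableOn_Ioc_of_le zero_le_one]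
      exact intervalIntegral.intervalIntegrable_rpow' (by linarith)
    refine h1.congr_fun (fun r hr => ?_) measurableSet_Ioc
    simp only [smul_eq_mul]
    have hr2 : r ^ 2 ≤ 1 := by have := hr.1; have := hr.2; nlinarith
    rw [min_eq_right hr2, e0 r hr.1, e1, ← rpow_two, ← rpow_add hr.1, ← rpow_add hr.1]
    congr 1; ring
  · have h1 : IntegrableOn (fun r : ℝ => r ^ ((Module.finrank ℝ V : ℝ) - 1 - p)) (Set.Ioi 1) :=
      integrableOn_Ioi_rpow_of_lt (by linarith) one_pos
    refine h1.congr_fun (fun r (hr : 1 < r) => ?_) measurableSet_Ioi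
    simp only [smul_eq_mul]
    have hr0 : 0 < r := by linarith
    have hr2 : 1 ≤ r ^ 2 := by nlinarith
    rw [min_eq_left hr2, e0 r hr0, e1, one_mul, ← rpow_add hr0]
    congr 1

end meas


section main
variable {V : Type*} [NormedAddCommGroup V] [InnerProductSpace ℝ V] [FiniteDimensional ℝ V]
  [MeasurableSpace V] [BorelSpace V]

/-- the triple integrand -/
noncomputable def auxK (x : V) (s b : ℝ) (z : V × (ℝ × ℝ)) : ℝ :=
  (z.2.1 ^ (s - 1) * rexp (-(1 * z.2.1)) * auxD x z.1 z.2.1) *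
    (z.2.1 ^ b * (z.2.2 ^ (b - 1) * rexp (-(z.2.1 * ‖z.1‖ ^ 2 * z.2.2))))

theorem auxK_measurable (x : V) (s b : ℝ) : Measurable (auxK x s b) := by
  unfold auxK auxD
  fun_prop

theorem aux_f_int {s : ℝ} (hs : 0 < s) :
    IntegrableOn (fun t : ℝ => t ^ (s - 1) * rexp (-(1 * t)) * (1 + t + 2 * t ^ 2)) (Set.Ioi 0) := by
  have h := ((aux_gam_int hs one_pos).add (aux_gam_int (by linarith : 0 < s + 1) one_pos)).add
    ((aux_gam_int (by linarith : 0 < s + 2) one_pos).const_mul 2)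
  refine IntegrableOn.congr_fun h (fun t (ht : 0 < t) => ?_) measurableSet_Ioi
  simp only [Pi.add_apply]
  rw [show s + 1 - 1 = (s - 1) + 1 by ring, show s + 2 - 1 = (s - 1) + 2 by ring, rpow_add ht,
    rpow_add ht, rpow_one, rpow_two]
  ring

theorem auxK_integrable [Nontrivial V] (x : V) (hx : ‖x‖ ≤ 1) {s b : ℝ} (hs : 0 < s)
    (hb : (Module.finrank ℝ V : ℝ) < 2 * b) (hb2 : 2 * b < Module.finrank ℝ V + 2) :
    Integrable (auxK x s b) ((volume : Measure V).prod
      ((volume.restrict (Set.Ioi (0 : ℝ))).prod (volume.restrict (Set.Ioi (0 : ℝ))))) := by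
  have hb0 : 0 < b := by have : (0 : ℝ) ≤ Module.finrank ℝ V := Nat.cast_nonneg _
                         linarith
  set μ : Measure ℝ := volume.restrict (Set.Ioi 0) with hμ
  let f : ℝ → ℝ := fun t => t ^ (s - 1) * rexp (-(1 * t)) * (1 + t + 2 * t ^ 2)
  have hf : Measurable f := by fun_prop
  let M : V × (ℝ × ℝ) → ℝ := fun z => min 1 (‖z.1‖ ^ 2) * (f z.2.1 *
    (z.2.1 ^ b * (z.2.2 ^ (b - 1) * rexp (-(z.2.1 * ‖z.1‖ ^ 2 * z.2.2)))))
  have hmem : ∀ᵐ z ∂(μ.prod μ), 0 < z.1 ∧ 0 < z.2 := by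
    rw [hμ, Measure.prod_restrict]
    filter_upwards [ae_restrict_mem (measurableSet_Ioi.prod measurableSet_Ioi)] with z hz
    exact ⟨hz.1, hz.2⟩
  have hMmeas : Measurable M := by fun_prop
  have hM0 : ∀ h : V, ∀ z : ℝ × ℝ, 0 < z.1 → 0 < z.2 → 0 ≤ M (h, z) := by
    intro h z h1 h2
    simp only [M, f]
    have : 0 ≤ min 1 (‖h‖ ^ 2) := by positivity
    positivity
  have hMint : Integrable M (volume.prod (μ.prod μ)) := by
    rw [integrable_prod_iff hMmeas.aestronglyMeasurable]
    have hcase : ∀ h : V, Integrable (fun z => M (h, z)) (μ.prod μ) ∧ ∫ z, M (h, z) ∂(μ.prod μ) =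
        (min 1 (‖h‖ ^ 2) * (‖h‖ ^ 2) ^ (-(2 * b / 2))) * ((∫ t in Set.Ioi (0 : ℝ), f t) * Real.Gamma b) := by
      intro h
      rcases eq_or_ne h 0 with rfl | hh
      · simp [M]
      · have hN := aux_N hb0 (norm_pos_iff.2 hh) hf (aux_f_int hs)
        refine ⟨hN.1.const_mul (min 1 (‖h‖ ^ 2)), ?_⟩
        simp only [M]
        rw [integral_const_mul, hN.2, show 2 * b / 2 = b by ring]
        ring
    refine ⟨ae_of_all _ fun h => (hcase h).1, ?_⟩
    refine ((aux_g_int (V := V) hb hb2).mul_const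
      ((∫ t in Set.Ioi (0 : ℝ), f t) * Real.Gamma b)).congr (ae_of_all _ fun h => ?_)
    dsimp only
    rw [← (hcase h).2]
    refine integral_congr_ae ?_
    filter_upwards [hmem] with z hz
    exact (Real.norm_of_nonneg (hM0 h z hz.1 hz.2)).symm
  refine hMint.mono' (auxK_measurable x s b).aestronglyMeasurable ?_
  have : ∀ᵐ z ∂((volume : Measure V).prod (μ.prod μ)), 0 < z.2.1 ∧ 0 < z.2.2 :=
    Measure.quasiMeasurePreserving_snd.ae hmem
  filter_upwards [this] with z hz
  obtain ⟨h1, h2⟩ := hz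
  have hD := auxD_bound x z.1 hx h1
  simp only [auxK, M, f]
  rw [norm_mul, norm_mul, Real.norm_of_nonneg (by positivity : 0 ≤ z.2.1 ^ (s - 1) * rexp (-(1 * z.2.1))),
    Real.norm_of_nonneg (by positivity :
      0 ≤ (z.2.1 ^ b * (z.2.2 ^ (b - 1) * rexp (-(z.2.1 * ‖z.1‖ ^ 2 * z.2.2))))), Real.norm_eq_abs]
  calc _ ≤ (z.2.1 ^ (s - 1) * rexp (-(1 * z.2.1)) * ((1 + z.2.1 + 2 * z.2.1 ^ 2) * min 1 (‖z.1‖ ^ 2))) *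
      (z.2.1 ^ b * (z.2.2 ^ (b - 1) * rexp (-(z.2.1 * ‖z.1‖ ^ 2 * z.2.2)))) := by gcongr
    _ = _ := by ring

/-- symmetrised second difference of the GIMQ function -/
noncomputable def auxU (x : V) (s : ℝ) (h : V) : ℝ :=
  (1 + ‖x‖ ^ 2) ^ (-s) - ((1 + ‖x + h‖ ^ 2) ^ (-s) + (1 + ‖x - h‖ ^ 2) ^ (-s)) / 2

theorem auxU_int (x h : V) {s : ℝ} (hs : 0 < s) :
    IntegrableOn (fun t : ℝ => t ^ (s - 1) * rexp (-(1 * t)) * auxD x h t) (Set.Ioi 0) ∧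
    ∫ t in Set.Ioi (0 : ℝ), t ^ (s - 1) * rexp (-(1 * t)) * auxD x h t =
      Real.Gamma s * auxU x s h := by
  have i := fun y : V => aux_gam_int hs (by positivity : 0 < 1 + ‖y‖ ^ 2)
  have v := fun y : V => aux_gam hs (by positivity : 0 < 1 + ‖y‖ ^ 2)
  have e : ∀ t : ℝ, t ^ (s - 1) * rexp (-(1 * t)) * auxD x h t =
      t ^ (s - 1) * rexp (-((1 + ‖x‖ ^ 2) * t)) - (t ^ (s - 1) * rexp (-((1 + ‖x + h‖ ^ 2) * t)) +
        t ^ (s - 1) * rexp (-((1 + ‖x - h‖ ^ 2) * t))) / 2 := by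
    intro t
    have e2 : ∀ y : V, rexp (-((1 + ‖y‖ ^ 2) * t)) = rexp (-(1 * t)) * rexp (-(t * ‖y‖ ^ 2)) := by
      intro y; rw [← Real.exp_add]; ring_nf
    rw [e2, e2, e2, auxD]; ring
  simp_rw [e]
  have i2 := (((i (x + h)).fun_add (i (x - h))).div_const 2)
  refine ⟨(i x).fun_sub i2, ?_⟩
  rw [integral_sub (i x) i2, integral_div, integral_add (i (x + h)) (i (x - h)), v, v, v, auxU]
  ring

theorem auxK_int_z (x h : V) {s b : ℝ} (hs : 0 < s) (hb : 0 < b) :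
    ∫ z, auxK x s b (h, z) ∂((volume.restrict (Set.Ioi (0 : ℝ))).prod
      (volume.restrict (Set.Ioi (0 : ℝ)))) =
    Real.Gamma s * Real.Gamma b * (auxU x s h * (‖h‖ ^ 2) ^ (-b)) := by
  rcases eq_or_ne h 0 with rfl | hh
  · simp [auxK, auxD, auxU]
  · have hm : Measurable (fun t : ℝ => t ^ (s - 1) * rexp (-(1 * t)) * auxD x h t) := by
      unfold auxD; fun_prop
    have := (aux_N hb (norm_pos_iff.2 hh) hm (auxU_int x h hs).1).2
    rw [(auxU_int x h hs).2] at this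
    simp only [auxK]
    rw [this]; ring

theorem auxK_int_h (x : V) {s a t σ : ℝ} (ht : 0 < t) (hσ : 0 < σ) :
    ∫ h : V, auxK x s ((Module.finrank ℝ V : ℝ) / 2 + a) (h, (t, σ)) =
      π ^ ((Module.finrank ℝ V : ℝ) / 2) * (σ ^ (a - 1) *
        (t ^ (s + a - 1) * rexp (-((1 + ‖x‖ ^ 2) * t)) -
          (σ / (1 + σ)) ^ ((Module.finrank ℝ V : ℝ) / 2) *
            (t ^ (s + a - 1) * rexp (-((1 + σ / (1 + σ) * ‖x‖ ^ 2) * t))))) := by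
  set c := (Module.finrank ℝ V : ℝ) / 2 with hc
  have e : ∀ h : V, auxK x s (c + a) (h, (t, σ)) =
      (t ^ (s - 1) * rexp (-(1 * t)) * (t ^ (c + a) * σ ^ (c + a - 1))) *
        (rexp (-(t * ‖h‖ ^ 2 * σ)) * auxD x h t) := by
    intro h; simp only [auxK]; ring
  simp_rw [e]
  rw [integral_const_mul, aux_inner_h x ht hσ, ← hc]
  rw [show -((1 + ‖x‖ ^ 2) * t) = -(1 * t) + -(t * ‖x‖ ^ 2) by ring, Real.exp_add,
    show -((1 + σ / (1 + σ) * ‖x‖ ^ 2) * t) = -(1 * t) + -(t * (σ / (1 + σ) * ‖x‖ ^ 2)) by ring,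
    Real.exp_add, div_rpow pi_pos.le (by positivity), div_rpow pi_pos.le (by positivity),
    mul_rpow ht.le hσ.le, mul_rpow ht.le (by positivity), div_rpow hσ.le (by positivity),
    show s + a - 1 = (s - 1) + a by ring, rpow_add ht c a, rpow_add ht (s - 1) a,
    show c + a - 1 = c + (a - 1) by ring, rpow_add hσ]
  have h1 : 0 < t ^ c := by positivity
  have h2 : 0 < σ ^ c := by positivity
  have h3 : 0 < (1 + σ) ^ c := by positivity
  field_simp

theorem auxU_main [Nontrivial V] (x : V) (hx : ‖x‖ < 1) {s a : ℝ} (hs : 0 < s) (ha : 0 < a)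
    (ha1 : a < 1) :
    Integrable (fun h : V => auxU x s h * (‖h‖ ^ 2) ^ (-((Module.finrank ℝ V : ℝ) / 2 + a))) ∧
    Real.Gamma s * Real.Gamma ((Module.finrank ℝ V : ℝ) / 2 + a) *
      (∫ h : V, auxU x s h * (‖h‖ ^ 2) ^ (-((Module.finrank ℝ V : ℝ) / 2 + a))) =
    π ^ ((Module.finrank ℝ V : ℝ) / 2) * (Real.Gamma (s + a) *
      ∫ t in Set.Ioi (0 : ℝ), t ^ (a - 1) * ((1 + ‖x‖ ^ 2) ^ (-(s + a)) -
        (t / (1 + t)) ^ ((Module.finrank ℝ V : ℝ) / 2) *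
          (1 + t / (1 + t) * ‖x‖ ^ 2) ^ (-(s + a)))) := by
  have hd : 0 < Module.finrank ℝ V := Module.finrank_pos
  set c := (Module.finrank ℝ V : ℝ) / 2 with hc
  have hd' : (Module.finrank ℝ V : ℝ) = 2 * c := by rw [hc]; ring
  have hc0 : 0 < c := by positivity
  set μ : Measure ℝ := volume.restrict (Set.Ioi 0) with hμ
  have hK := auxK_integrable x hx.le (b := c + a) hs (by linarith) (by linarith)
  have hgs := Real.Gamma_pos_of_pos hs
  have hgb := Real.Gamma_pos_of_pos (by positivity : 0 < c + a)
  constructor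
  · have := hK.integral_prod_left.const_mul (Real.Gamma s * Real.Gamma (c + a))⁻¹
    refine this.congr (ae_of_all _ fun h => ?_)
    dsimp only
    rw [auxK_int_z x h hs (by positivity)]
    field_simp
  · rw [← integral_const_mul]
    have e1 : ∀ h : V, Real.Gamma s * Real.Gamma (c + a) * (auxU x s h * (‖h‖ ^ 2) ^ (-(c + a))) =
        ∫ z, auxK x s (c + a) (h, z) ∂(μ.prod μ) :=
      fun h => (auxK_int_z x h hs (by positivity)).symm
    simp_rw [e1]
    rw [← integral_prod _ hK, integral_prod_symm _ hK,
      integral_prod_symm _ hK.integral_prod_right, ← integral_const_mul, ← integral_const_mul]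
    refine setIntegral_congr_fun measurableSet_Ioi fun σ (hσ : 0 < σ) => ?_
    have e2 : ∫ t in Set.Ioi (0 : ℝ), ∫ h : V, auxK x s (c + a) (h, (t, σ)) =
        ∫ t in Set.Ioi (0 : ℝ), π ^ c * (σ ^ (a - 1) *
        (t ^ (s + a - 1) * rexp (-((1 + ‖x‖ ^ 2) * t)) -
          (σ / (1 + σ)) ^ c *
            (t ^ (s + a - 1) * rexp (-((1 + σ / (1 + σ) * ‖x‖ ^ 2) * t))))) :=
      setIntegral_congr_fun measurableSet_Ioi fun t (ht : 0 < t) => auxK_int_h x ht hσ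
    have p1 : 0 < 1 + ‖x‖ ^ 2 := by positivity
    have p2 : 0 < 1 + σ / (1 + σ) * ‖x‖ ^ 2 := by positivity
    have hq : 0 < s + a := by positivity
    rw [e2, integral_const_mul, integral_const_mul, integral_sub (aux_gam_int hq p1)
      ((aux_gam_int hq p2).const_mul _), integral_const_mul, aux_gam hq p1, aux_gam hq p2]
    ring

end main


section limit
variable {V : Type*} [NormedAddCommGroup V] [InnerProductSpace ℝ V] [FiniteDimensional ℝ V]
  [MeasurableSpace V] [BorelSpace V]

theorem aux_lim {E : V → ℝ} (hE : Integrable E) (h0 : E 0 = 0) :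
    Tendsto (fun ε : ℝ => ∫ h, {h : V | ε < ‖h‖}.indicator E h) (𝓝[>] 0) (𝓝 (∫ h, E h)) := by
  refine tendsto_integral_filter_of_dominated_convergence (fun h => ‖E h‖) ?_ ?_ hE.norm ?_
  · refine Eventually.of_forall fun ε => hE.aestronglyMeasurable.indicator ?_
    exact measurableSet_lt measurable_const measurable_norm
  · exact Eventually.of_forall fun ε => ae_of_all _ fun h => norm_indicator_le_norm_self _ _
  · refine ae_of_all _ fun h => ?_
    rcases eq_or_ne h 0 with rfl | hh
    · have : ∀ ε : ℝ, {h : V | ε < ‖h‖}.indicator E 0 = 0 := by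
        intro ε
        by_cases hm : (0 : V) ∈ {h : V | ε < ‖h‖}
        · rw [Set.indicator_of_mem hm, h0]
        · rw [Set.indicator_of_notMem hm]
      simp_rw [this, h0]
      exact tendsto_const_nhds
    · refine tendsto_const_nhds.congr' ?_
      have : Set.Iio ‖h‖ ∈ 𝓝[>] (0 : ℝ) := mem_nhdsWithin_of_mem_nhds (Iio_mem_nhds (norm_pos_iff.2 hh))
      filter_upwards [this] with ε hε
      rw [Set.indicator_of_mem (show h ∈ {h : V | ε < ‖h‖} from hε)]

theorem aux_sym [Nontrivial V] (u : V → ℝ) {s a p : ℝ} (hs : 0 < s) (ha : 0 < a) (ha1 : a < 1)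
    (hp : p = Module.finrank ℝ V + 2 * a)
    (hu : ∀ x, u x = (1 + ‖x‖ ^ 2) ^ (-s)) (x : V) {ε : ℝ} (hε : 0 < ε) :
    ∫ y in {y : V | ε < ‖x - y‖}, (u x - u y) / ‖x - y‖ ^ p =
      ∫ h, {h : V | ε < ‖h‖}.indicator
        (fun h => auxU x s h * (‖h‖ ^ 2) ^ (-((Module.finrank ℝ V : ℝ) / 2 + a))) h := by
  set b := (Module.finrank ℝ V : ℝ) / 2 + a with hb
  have hpow : ∀ h : V, (‖h‖ ^ p)⁻¹ = (‖h‖ ^ 2) ^ (-b) := by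
    intro h
    rw [← rpow_neg (norm_nonneg h), ← rpow_natCast, ← rpow_mul (norm_nonneg h), hp, hb]
    congr 1; push_cast; ring
  have hmu : Measurable u := by
    rw [show u = fun x => (1 + ‖x‖ ^ 2) ^ (-s) from funext hu]; fun_prop
  have hu01 : ∀ y, 0 ≤ u y ∧ u y ≤ 1 := by
    intro y
    rw [hu]
    refine ⟨by positivity, Real.rpow_le_one_of_one_le_of_nonpos ?_ (by linarith)⟩
    have : 0 ≤ ‖y‖ ^ 2 := by positivity
    linarith
  let φ : V → ℝ := {h : V | ε < ‖h‖}.indicator (fun h => (u x - u (x - h)) * (‖h‖ ^ 2) ^ (-b))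
  have hS : MeasurableSet {h : V | ε < ‖h‖} := measurableSet_lt measurable_const measurable_norm
  have hS' : MeasurableSet {y : V | ε < ‖x - y‖} := measurableSet_lt measurable_const (by fun_prop)
  have h1 : ∫ y in {y : V | ε < ‖x - y‖}, (u x - u y) / ‖x - y‖ ^ p = ∫ h, φ h := by
    rw [← integral_indicator hS', ← integral_sub_left_eq_self φ volume x]
    refine integral_congr_ae (ae_of_all _ fun y => ?_)
    by_cases hy : ε < ‖x - y‖
    · simp only [φ]
      rw [Set.indicator_of_mem (show y ∈ {y : V | ε < ‖x - y‖} from hy),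
        Set.indicator_of_mem (show x - y ∈ {h : V | ε < ‖h‖} from hy), sub_sub_cancel,
        div_eq_mul_inv, hpow]
    · simp only [φ]
      rw [Set.indicator_of_notMem (show y ∉ {y : V | ε < ‖x - y‖} from hy),
        Set.indicator_of_notMem (show x - y ∉ {h : V | ε < ‖h‖} from hy)]
  have hφ : Integrable φ := by
    have hg := (aux_g_int (V := V) (p := 2 * b) (by rw [hb]; linarith)
      (by rw [hb]; linarith)).const_mul (1 + (ε ^ 2)⁻¹)
    refine hg.mono' ?_ (ae_of_all _ fun h => ?_)
    · exact (Measurable.indicator (by fun_prop) hS).aestronglyMeasurable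
    · by_cases hh : ε < ‖h‖
      · simp only [φ]
        rw [Set.indicator_of_mem (show h ∈ {h : V | ε < ‖h‖} from hh), norm_mul,
          Real.norm_of_nonneg (by positivity : 0 ≤ (‖h‖ ^ 2) ^ (-b)), ← mul_assoc,
          show 2 * b / 2 = b by ring]
        gcongr
        have a1 : ‖u x - u (x - h)‖ ≤ 1 := by
          have := hu01 x
          have := hu01 (x - h)
          rw [Real.norm_eq_abs, abs_le]; constructor <;> linarith
        refine a1.trans ?_
        have hε2 : 0 < (ε ^ 2)⁻¹ := by positivity
        rcases le_total 1 (‖h‖ ^ 2) with h2 | h2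
        · rw [min_eq_left h2]; linarith
        · rw [min_eq_right h2]
          have h3 : ε ^ 2 ≤ ‖h‖ ^ 2 := by gcongr
          have h4 : 1 ≤ (ε ^ 2)⁻¹ * ‖h‖ ^ 2 := by
            rw [inv_mul_eq_div, one_le_div (by positivity)]; exact h3
          nlinarith [sq_nonneg ‖h‖]
      · simp only [φ]
        rw [Set.indicator_of_notMem (show h ∉ {h : V | ε < ‖h‖} from hh), norm_zero]
        positivity
  have h2 : ∫ h, φ h = ∫ h, (φ h + φ (-h)) / 2 := by
    rw [integral_div, integral_add hφ hφ.comp_neg, integral_neg_eq_self φ]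
    ring
  rw [h1, h2]
  refine integral_congr_ae (ae_of_all _ fun h => ?_)
  by_cases hh : ε < ‖h‖
  · simp only [φ]
    rw [Set.indicator_of_mem (show h ∈ {h : V | ε < ‖h‖} from hh),
      Set.indicator_of_mem (show h ∈ {h : V | ε < ‖h‖} from hh),
      Set.indicator_of_mem (show -h ∈ {h : V | ε < ‖h‖} by simpa using hh), norm_neg,
      sub_neg_eq_add, hu, hu, hu, auxU]
    ring
  · simp only [φ]
    rw [Set.indicator_of_notMem (show h ∉ {h : V | ε < ‖h‖} from hh),
      Set.indicator_of_notMem (show h ∉ {h : V | ε < ‖h‖} from hh),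
      Set.indicator_of_notMem (show -h ∉ {h : V | ε < ‖h‖} by simpa using hh)]
    simp

end limit

/-- For `d ≥ 1`, `α ∈ (0,2)` and `u(x) = (1+|x|²)^{-(d+1)/2}` on `ℝ^d`, for every
`x` with `|x| < 1` the principal value limit defining the fractional Laplacian of `u` at `x`
exists and equals `(2^{1-d} √π Γ(d+α)/(Γ(d/2)Γ((d+1)/2))) ₂F₁((d+α)/2, (d+1+α)/2; d/2; -|x|²)`,
the Gauss hypergeometric series converging absolutely. -/
theorem fracLap_GIMQ_hypergeometric (d : ℕ) (hd : 1 ≤ d) (α : ℝ) (hα : α ∈ Set.Ioo (0 : ℝ) 2)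
    (u : EuclideanSpace ℝ (Fin d) → ℝ)
    (hu : ∀ x, u x = (1 + ‖x‖ ^ 2) ^ (-((d : ℝ) + 1) / 2))
    (x : EuclideanSpace ℝ (Fin d)) (hx : ‖x‖ < 1) :
    Summable (fun k : ℕ =>
      |((ascPochhammer ℝ k).eval (((d : ℝ) + α) / 2) *
          (ascPochhammer ℝ k).eval (((d : ℝ) + 1 + α) / 2) /
            ((ascPochhammer ℝ k).eval ((d : ℝ) / 2) * (Nat.factorial k : ℝ))) *
        (-‖x‖ ^ 2) ^ k|) ∧
    Tendsto
      (fun ε : ℝ => fracLapConst d α *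
        ∫ y in {y : EuclideanSpace ℝ (Fin d) | ε < ‖x - y‖},
          (u x - u y) / ‖x - y‖ ^ ((d : ℝ) + α))
      (𝓝[>] 0)
      (𝓝 ((2 ^ (1 - (d : ℝ)) * Real.sqrt Real.pi * Real.Gamma ((d : ℝ) + α) /
            (Real.Gamma ((d : ℝ) / 2) * Real.Gamma (((d : ℝ) + 1) / 2))) *
        ∑' k : ℕ,
          ((ascPochhammer ℝ k).eval (((d : ℝ) + α) / 2) *
              (ascPochhammer ℝ k).eval (((d : ℝ) + 1 + α) / 2) /
                ((ascPochhammer ℝ k).eval ((d : ℝ) / 2) * (Nat.factorial k : ℝ))) *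
            (-‖x‖ ^ 2) ^ k)) := by
  obtain ⟨hα0, hα2⟩ := hα
  have hdpos : (0 : ℝ) < d := by exact_mod_cast hd
  have hρ : ‖x‖ ^ 2 < 1 := by nlinarith [norm_nonneg x]
  refine ⟨aux_summable _ _ _ _ (by positivity) (by positivity) (by positivity) ?_, ?_⟩
  · rw [abs_neg, abs_of_nonneg (by positivity)]; exact hρ
  have hfr : Module.finrank ℝ (EuclideanSpace ℝ (Fin d)) = d := finrank_euclideanSpace_fin
  haveI : Nontrivial (EuclideanSpace ℝ (Fin d)) :=
    Module.nontrivial_of_finrank_pos (R := ℝ) (by rw [hfr]; exact hd)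
  have hs : 0 < ((d : ℝ) + 1) / 2 := by positivity
  have ha : 0 < α / 2 := by positivity
  have ha1 : α / 2 < 1 := by linarith
  obtain ⟨hIntg, hval⟩ := auxU_main x hx hs ha ha1
  rw [aux_final ha ha1 (by positivity) (by rw [hfr]; positivity) (by positivity) hρ] at hval
  have hlim := (aux_lim hIntg (by simp [auxU])).const_mul (fracLapConst d α)
  rw [hfr] at hval
  have hu' : ∀ y, u y = (1 + ‖y‖ ^ 2) ^ (-(((d : ℝ) + 1) / 2)) := by
    intro y; rw [hu, neg_div]
  have hconst : fracLapConst d α * (∫ h : EuclideanSpace ℝ (Fin d),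
      auxU x (((d : ℝ) + 1) / 2) h * (‖h‖ ^ 2) ^
        (-((Module.finrank ℝ (EuclideanSpace ℝ (Fin d)) : ℝ) / 2 + α / 2))) =
      (2 ^ (1 - (d : ℝ)) * Real.sqrt Real.pi * Real.Gamma ((d : ℝ) + α) /
            (Real.Gamma ((d : ℝ) / 2) * Real.Gamma (((d : ℝ) + 1) / 2))) *
        ∑' k : ℕ,
          ((ascPochhammer ℝ k).eval (((d : ℝ) + α) / 2) *
              (ascPochhammer ℝ k).eval (((d : ℝ) + 1 + α) / 2) /
                ((ascPochhammer ℝ k).eval ((d : ℝ) / 2) * (Nat.factorial k : ℝ))) *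
            (-‖x‖ ^ 2) ^ k := by
    rw [hfr]
    have e1 : (d : ℝ) / 2 + α / 2 = ((d : ℝ) + α) / 2 := by ring
    have e2 : ((d : ℝ) + 1) / 2 + α / 2 = ((d : ℝ) + 1 + α) / 2 := by ring
    rw [e1, e2] at hval
    rw [e1]
    generalize (∑' k : ℕ,
          ((ascPochhammer ℝ k).eval (((d : ℝ) + α) / 2) *
              (ascPochhammer ℝ k).eval (((d : ℝ) + 1 + α) / 2) /
                ((ascPochhammer ℝ k).eval ((d : ℝ) / 2) * (Nat.factorial k : ℝ))) *
            (-‖x‖ ^ 2) ^ k) = S at hval ⊢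
    generalize (∫ h : EuclideanSpace ℝ (Fin d),
      auxU x (((d : ℝ) + 1) / 2) h * (‖h‖ ^ 2) ^ (-(((d : ℝ) + α) / 2))) = I at hval ⊢
    have dup := Real.Gamma_mul_Gamma_add_half (((d : ℝ) + α) / 2)
    rw [show ((d : ℝ) + α) / 2 + 1 / 2 = ((d : ℝ) + 1 + α) / 2 by ring,
      show 2 * (((d : ℝ) + α) / 2) = d + α by ring] at dup
    have pw : (2 : ℝ) ^ (1 - (d : ℝ)) = 2 * 2 ^ (α - 1) * 2 ^ (1 - ((d : ℝ) + α)) := by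
      rw [mul_assoc, ← rpow_add two_pos]
      nth_rewrite 2 [← rpow_one (2 : ℝ)]
      rw [← rpow_add two_pos]; congr 1; ring
    unfold fracLapConst
    rw [add_comm α (d : ℝ), pw]
    have g1 := Real.Gamma_pos_of_pos hs
    have g2 := Real.Gamma_pos_of_pos (by positivity : 0 < ((d : ℝ) + α) / 2)
    have g3 := Real.Gamma_pos_of_pos (by linarith : 0 < 1 - α / 2)
    have g4 := Real.Gamma_pos_of_pos (by positivity : 0 < (d : ℝ) / 2)
    have g5 : 0 < Real.pi ^ ((d : ℝ) / 2) := by positivity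
    have hI : I = Real.pi ^ ((d : ℝ) / 2) * (Real.Gamma (((d : ℝ) + 1 + α) / 2) *
        (Real.Gamma (1 - α / 2) / (α / 2) *
          (Real.Gamma (((d : ℝ) + α) / 2) / Real.Gamma ((d : ℝ) / 2)) * S)) /
        (Real.Gamma (((d : ℝ) + 1) / 2) * Real.Gamma (((d : ℝ) + α) / 2)) := by
      rw [eq_div_iff (by positivity), ← hval]; ring
    have dup2 : 2 ^ (1 - ((d : ℝ) + α)) * Real.sqrt Real.pi * Real.Gamma ((d : ℝ) + α) =
        Real.Gamma (((d : ℝ) + α) / 2) * Real.Gamma (((d : ℝ) + 1 + α) / 2) := by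
      rw [dup]; ring
    rw [mul_assoc (2 * (2 : ℝ) ^ (α - 1)), mul_assoc (2 * (2 : ℝ) ^ (α - 1)), dup2, hI]
    field_simp
  rw [← hconst]
  refine hlim.congr' ?_
  filter_upwards [self_mem_nhdsWithin] with ε hε
  rw [aux_sym u hs ha ha1 (by rw [hfr]; ring) hu' x hε]
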